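/- Let A be a finite set with |A| = n ≥ 2 and f : 2^A → ℝ≥0 a symmetric submodular function with f(∅) = 0. Let (T, w) be a Gomory–Hu tree of f, i.e., T is a tree on vertex set A and w : E(T) → ℝ such that for every edge e = (s,t) ∈ E(T), letting X_e be the vertex set of the connected component of T − e containing s, one has w(e) = f(X_e) and f(X_e) ≤ f(X) for every X ⊆ A with s ∈ X and t ∉ X. Then for every bijection σ : A → {1,…,n}: ∑_{i=1}^{n−1} f(A_{i,σ}) ≥ ∑_{e ∈ E(T)} w(e). -/

import Mathlib

open scoped Classical

/-- The prefix set `A_{i,σ} = {a : σ(a) ≤ i}`, where the bijection `σ : α ≃ Fin n`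
is interpreted as a labeling by `{1,…,n}` via `a ↦ (σ a) + 1`. -/
def prefixSet {α : Type*} [Fintype α] [DecidableEq α] {n : ℕ} (σ : α ≃ Fin n) (i : ℕ) :
    Finset α :=
  Finset.univ.filter fun e => (σ e : ℕ) < i

/-- The vertex set of the connected component of `T` with the edge `e` deleted
that contains `s`. -/
noncomputable def sideOf {α : Type*} [Fintype α] (T : SimpleGraph α) (e : Sym2 α) (s : α) :
    Finset α :=
  Finset.univ.filter fun a => (T.deleteEdges {e}).Reachable s a

/-- `(T, w)` is a Gomory–Hu tree of `f`: `T` is a tree on the ground set, and for every edge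
`(s,t)` of `T`, the side of the edge containing `s` is a minimum `s`-`t` cut whose value is the
weight of the edge. -/
noncomputable def IsGomoryHuTree {α : Type*} [Fintype α] (f : Finset α → ℝ)
    (T : SimpleGraph α) (w : Sym2 α → ℝ) : Prop :=
  T.IsTree ∧
    ∀ s t : α, T.Adj s t →
      w s(s, t) = f (sideOf T s(s, t) s) ∧
      ∀ X : Finset α, s ∈ X → t ∉ X → f (sideOf T s(s, t) s) ≤ f X

/-- The total weight `∑_{e ∈ E(T)} w(e)` of the edges of `T`. -/
noncomputable def treeEdgeSum {α : Type*} [Fintype α] (T : SimpleGraph α)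
    (w : Sym2 α → ℝ) : ℝ :=
  ∑ e ∈ Finset.univ.filter (fun e : Sym2 α => e ∈ T.edgeSet), w e

/-- The set of those edges of `T` that have an endpoint of label at most `i` and an endpoint of
label greater than `i`. -/
noncomputable def crossingEdges {α : Type*} [Fintype α] {n : ℕ} (T : SimpleGraph α)
    (σ : α ≃ Fin n) (i : ℕ) : Finset (Sym2 α) :=
  Finset.univ.filter fun e => ∃ u v, e = s(u, v) ∧ T.Adj u v ∧ (σ u : ℕ) ≤ i ∧ i < (σ v : ℕ)

theorem mem_crossingEdges {α : Type*} [Fintype α] {n : ℕ} {T : SimpleGraph α}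
    {σ : α ≃ Fin n} {i : ℕ} {e : Sym2 α} : e ∈ crossingEdges T σ i ↔
      ∃ u v, e = s(u, v) ∧ T.Adj u v ∧ (σ u : ℕ) ≤ i ∧ i < (σ v : ℕ) := by
  simp only [crossingEdges, Finset.mem_filter, Finset.mem_univ, true_and]

theorem reachable_of_consecutive_reachable {α : Type*} {n : ℕ} (G : SimpleGraph α)
    (σ : α ≃ Fin n) {a b : ℕ} (hab : a ≤ b) (hb : b < n)
    (h : ∀ i (hi : i + 1 < n), a ≤ i → i < b →
      G.Reachable (σ.symm ⟨i, by omega⟩) (σ.symm ⟨i + 1, hi⟩)) :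
    G.Reachable (σ.symm ⟨a, by omega⟩) (σ.symm ⟨b, hb⟩) := by
  induction b, hab using Nat.le_induction with
  | base => exact SimpleGraph.Reachable.refl _
  | succ b hab ih =>
    exact (ih (by omega) fun i hi h₁ h₂ => h i hi h₁ (by omega)).trans
      (h b hb hab (by omega))

/-- A connected graph has at least `#I` edges crossing one of the prefixes indexed by `I`. -/
theorem card_le_card_biUnion_crossingEdges {α : Type*} [Fintype α] [DecidableEq α] {n : ℕ}
    {T : SimpleGraph α} (hT : T.Connected) (σ : α ≃ Fin n) (I : Finset (Fin (n - 1))) :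
    I.card ≤ (I.biUnion fun i => crossingEdges T σ i).card := by
  set C := I.biUnion fun i => crossingEdges T σ i
  let p : Fin (n - 1) → Sym2 α := fun i =>
    s(σ.symm ⟨i, by omega⟩, σ.symm ⟨i + 1, by omega⟩)
  let G : SimpleGraph α := SimpleGraph.fromEdgeSet (↑(C ∪ Iᶜ.image p) : Set (Sym2 α))
  have hpath : ∀ u v, (σ u : ℕ) ≤ σ v →
      (∀ i ∈ I, ¬ ((σ u : ℕ) ≤ i ∧ (i : ℕ) < σ v)) → G.Reachable u v := by
    intro u v huv h
    have := reachable_of_consecutive_reachable G σ huv (σ v).2 fun i hi h₁ h₂ => by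
      refine SimpleGraph.Adj.reachable ((SimpleGraph.fromEdgeSet_adj _).2 ⟨?_, by simp⟩)
      have hi' : (⟨i, by omega⟩ : Fin (n - 1)) ∉ I := fun hI => h _ hI ⟨h₁, h₂⟩
      exact Finset.mem_coe.2 (Finset.mem_union_right _
        (Finset.mem_image.2 ⟨⟨i, by omega⟩, Finset.mem_compl.2 hi', rfl⟩))
    simpa using this
  have hstep : ∀ u v, T.Adj u v → (σ u : ℕ) ≤ σ v → G.Reachable u v := by
    intro u v hadj huv
    by_cases h : ∃ i ∈ I, (σ u : ℕ) ≤ i ∧ (i : ℕ) < σ v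
    · obtain ⟨i, hi, h₁, h₂⟩ := h
      refine SimpleGraph.Adj.reachable ((SimpleGraph.fromEdgeSet_adj _).2 ⟨?_, hadj.ne⟩)
      refine Finset.mem_coe.2 (Finset.mem_union_left _ (Finset.mem_biUnion.2 ⟨i, hi, ?_⟩))
      exact mem_crossingEdges.2 ⟨u, v, rfl, hadj, h₁, h₂⟩
    · push Not at h
      exact hpath u v huv fun i hi hc => absurd hc.2 (not_lt.2 (h i hi hc.1))
  have hadj : ∀ u v, T.Adj u v → G.Reachable u v := fun u v h =>
    (le_total (σ u : ℕ) (σ v)).elim (hstep u v h) fun h' => (hstep v u h.symm h').symm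
  have hG : G.Connected := by
    have := hT.nonempty
    refine SimpleGraph.Connected.mk fun u v => ?_
    obtain ⟨q⟩ := hT.preconnected u v
    induction q with
    | nil => exact SimpleGraph.Reachable.refl _
    | cons h _ ih => exact (hadj _ _ h).trans ih
  have hcard := hG.card_vert_le_card_edgeSet_add_one
  have hsub : G.edgeSet ⊆ (↑(C ∪ Iᶜ.image p) : Set (Sym2 α)) := by
    rw [SimpleGraph.edgeSet_fromEdgeSet]
    exact Set.sdiff_subset
  have h₁ : Nat.card G.edgeSet ≤ (C ∪ Iᶜ.image p).card := by
    rw [← Set.ncard_coe_finset]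
    exact Set.ncard_le_ncard hsub (Finset.finite_toSet _)
  have h₂ := Finset.card_union_le C (Iᶜ.image p)
  have h₃ : (Iᶜ.image p).card ≤ Iᶜ.card := Finset.card_image_le
  have h₄ : Iᶜ.card + I.card = n - 1 := by simp
  have h₅ : Nat.card α = n := by rw [Nat.card_congr σ, Nat.card_fin]
  omega

/-- The weight of a Gomory–Hu tree edge is at most the value of any prefix set it crosses. -/
theorem IsGomoryHuTree.weight_le_prefixSet {α : Type*} [Fintype α] [DecidableEq α] {n : ℕ}
    {f : Finset α → ℝ} {T : SimpleGraph α} {w : Sym2 α → ℝ} (hGH : IsGomoryHuTree f T w)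
    (σ : α ≃ Fin n) {i : ℕ} {e : Sym2 α} (he : e ∈ crossingEdges T σ i) :
    w e ≤ f (prefixSet σ (i + 1)) := by
  obtain ⟨u, v, rfl, hadj, hu, hv⟩ := mem_crossingEdges.1 he
  obtain ⟨hw, hmin⟩ := hGH.2 u v hadj
  rw [hw]
  refine hmin _ (Finset.mem_filter.2 ⟨Finset.mem_univ _, Nat.lt_succ_of_le hu⟩) fun h => ?_
  have := (Finset.mem_filter.1 h).2
  omega

theorem stmt_16 {α : Type*} [Fintype α] [DecidableEq α] {n : ℕ}
    (hn : Fintype.card α = n) (hn2 : 2 ≤ n) (f : Finset α → ℝ)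
    (hnn : ∀ S : Finset α, 0 ≤ f S)
    (hsub : ∀ S T : Finset α, f (S ∪ T) + f (S ∩ T) ≤ f S + f T)
    (hsym : ∀ S : Finset α, f S = f Sᶜ)
    (hzero : f ∅ = 0)
    (T : SimpleGraph α) (w : Sym2 α → ℝ) (hGH : IsGomoryHuTree f T w) :
    ∀ σ : α ≃ Fin n,
      treeEdgeSum T w ≤ ∑ i ∈ Finset.range (n - 1), f (prefixSet σ (i + 1)) := by
  intro σ
  obtain ⟨g, hinj, hg⟩ := (Finset.all_card_le_biUnion_card_iff_exists_injective
    fun i : Fin (n - 1) => crossingEdges T σ i).1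
      fun I => card_le_card_biUnion_crossingEdges hGH.1.connected σ I
  have hedges : Finset.univ.filter (fun e : Sym2 α => e ∈ T.edgeSet) = Finset.univ.image g := by
    refine (Finset.eq_of_subset_of_card_le ?_ ?_).symm
    · refine Finset.image_subset_iff.2 fun i _ => ?_
      obtain ⟨u, v, huv, hadj, -⟩ := mem_crossingEdges.1 (hg i)
      simpa [huv] using hadj
    · have hcard := hGH.1.card_edgeFinset
      rw [Finset.card_image_of_injective _ hinj, Finset.card_univ, Fintype.card_fin]
      have : Finset.univ.filter (fun e : Sym2 α => e ∈ T.edgeSet) = T.edgeFinset := by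
        ext e; simp
      rw [this]
      omega
  rw [treeEdgeSum, hedges, Finset.sum_image fun a _ b _ h => hinj h, ← Fin.sum_univ_eq_sum_range
    (fun i => f (prefixSet σ (i + 1)))]
  exact Finset.sum_le_sum fun i _ => hGH.weight_le_prefixSet σ (hg i)
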